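/- Let r ∈ (0,1], R > 0, and R' > r, with Rn, R'n, rn integers. There exist γ₀ > 0 and γ₁ > 0 (depending only on r and R') such that for every even integer k ≥ 4 and all sufficiently large n the following holds. Let 𝒞_n be a random [n,Rn,R'n] code whose 2^{(R+R')n} codewords x(m,w) ∈ {0,1}^n, indexed by (m,w) ∈ {0,1}^{Rn} × {0,1}^{R'n}, are k-wise independent with each codeword uniformly distributed on {0,1}^n. Then Pr[ Sem(𝒞_n) > 2^{−γ₁ r n} ] ≤ 2^{(−kγ₀ r + r + R + 1) n}. -/

import Mathlib

open Finset
open scoped Classical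

/-- Base-2 mutual information of a finite joint distribution `P` on `M × Z`
(marginals are computed from the joint). -/
noncomputable def mutualInfo {M Z : Type*} [Fintype M] [Fintype Z]
    (P : M → Z → ℝ) : ℝ :=
  ∑ m, ∑ z, P m z * Real.logb 2 (P m z / ((∑ z', P m z') * (∑ m', P m' z)))

/-- Semantic leakage of a stochastic code with encoder `x : M → W → {0,1}ⁿ` against an
adversary reading `s` coordinates. -/
noncomputable def semLeak {n : ℕ} {M W : Type*} [Fintype M] [Fintype W]
    (s : ℕ) (x : M → W → Fin n → ZMod 2) : ℝ :=
  sSup { I : ℝ | ∃ (PM : M → ℝ) (S : Finset (Fin n)),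
    (∀ m, 0 ≤ PM m) ∧ (∑ m, PM m = 1) ∧ S.card = s ∧
    I = mutualInfo (fun m (z : {i : Fin n // i ∈ S} → ZMod 2) =>
      PM m * (((Finset.univ.filter (fun w : W =>
        (fun i : {i : Fin n // i ∈ S} => x m w i.val) = z)).card : ℝ)
        / (Fintype.card W : ℝ))) }

/-- Probability of event `E` on a finite space with mass function `μ`. -/
noncomputable def pr {Ω : Type*} [Fintype Ω] (μ : Ω → ℝ) (E : Ω → Prop) : ℝ :=
  ∑ ω ∈ Finset.univ.filter E, μ ω

/-- A family `X : W → Ω → α` of random variables is `k`-wise independent (under `μ`)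
if every subfamily of size at most `k` is mutually independent. -/
def kWiseIndep {Ω W α : Type*} [Fintype Ω] (μ : Ω → ℝ) (X : W → Ω → α) (k : ℕ) : Prop :=
  ∀ S : Finset W, S.card ≤ k → ∀ f : W → α,
    pr μ (fun ω => ∀ w ∈ S, X w ω = f w) = ∏ w ∈ S, pr μ (fun ω => X w ω = f w)

section FiniteProbability

variable {Ω : Type*} [Fintype Ω] {μ : Ω → ℝ}

theorem pr_mono (hμ : ∀ ω, 0 ≤ μ ω) {E F : Ω → Prop} (h : ∀ ω, E ω → F ω) :
    pr μ E ≤ pr μ F := by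
  unfold pr
  refine Finset.sum_le_sum_of_subset_of_nonneg ?_ fun ω _ _ => hμ ω
  intro ω hω
  simp only [Finset.mem_filter, Finset.mem_univ, true_and] at hω ⊢
  exact h ω hω

theorem pr_exists_le (hμ : ∀ ω, 0 ≤ μ ω) {ι : Type*} (T : Finset ι) (E : ι → Ω → Prop)
    {c : ℝ} (hc : ∀ i ∈ T, pr μ (E i) ≤ c) :
    pr μ (fun ω => ∃ i ∈ T, E i ω) ≤ T.card * c := by
  calc pr μ (fun ω => ∃ i ∈ T, E i ω) ≤ ∑ i ∈ T, pr μ (E i) := by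
        simp only [pr, Finset.sum_filter]
        rw [Finset.sum_comm]
        refine Finset.sum_le_sum fun ω _ => ?_
        have hnn : ∀ i ∈ T, 0 ≤ if E i ω then μ ω else 0 := fun i _ => by
          split_ifs <;> simp [hμ]
        split_ifs with h
        · obtain ⟨i, hi, hE⟩ := h
          calc μ ω = if E i ω then μ ω else 0 := by rw [if_pos hE]
            _ ≤ _ := Finset.single_le_sum hnn hi
        · exact Finset.sum_nonneg hnn
    _ ≤ ∑ _i ∈ T, c := Finset.sum_le_sum hc
    _ = T.card * c := by simp

/-- Markov's inequality for an even power. -/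
theorem pr_lt_le_of_moment (hμ : ∀ ω, 0 ≤ μ ω) {Y : Ω → ℝ} {t B : ℝ} (ht : 0 < t) {k : ℕ}
    (hk : Even k) (hB : ∑ ω, μ ω * Y ω ^ k ≤ B) :
    pr μ (fun ω => t < Y ω) ≤ B / t ^ k := by
  rw [le_div_iff₀ (pow_pos ht k)]
  refine le_trans ?_ hB
  rw [pr, Finset.sum_filter, Finset.sum_mul]
  refine Finset.sum_le_sum fun ω _ => ?_
  split_ifs with h
  · exact mul_le_mul_of_nonneg_left (pow_le_pow_left₀ ht.le h.le k) (hμ ω)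
  · rw [zero_mul]
    exact mul_nonneg (hμ ω) (hk.pow_nonneg _)

theorem sum_mul_comp_eq {α : Type*} [Fintype α] (X : Ω → α) (φ : α → ℝ) :
    ∑ ω, μ ω * φ (X ω) = ∑ c, φ c * pr μ (fun ω => X ω = c) := by
  simp only [pr, Finset.mul_sum, Finset.sum_filter, mul_ite, mul_zero]
  rw [Finset.sum_comm]
  refine Finset.sum_congr rfl fun ω _ => ?_
  simp [mul_comm]

/-- Expectations of products factorize over small subfamilies of a `k`-wise independent family. -/
theorem kWiseIndep.sum_mul_prod {W α : Type*} [Fintype α] [Nonempty α] {X : W → Ω → α} {k : ℕ}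
    (h : kWiseIndep μ X k) {T : Finset W} (hT : T.card ≤ k) (φ : W → α → ℝ) :
    ∑ ω, μ ω * ∏ w ∈ T, φ w (X w ω) = ∏ w ∈ T, ∑ ω, μ ω * φ w (X w ω) := by
  have key : ∀ c : T → α, pr μ (fun ω => (fun w : T => X w ω) = c) =
      ∏ w : T, pr μ (fun ω => X w ω = c w) := by
    intro c
    let f : W → α := fun w => if hw : w ∈ T then c ⟨w, hw⟩ else Classical.arbitrary α
    have hf : ∀ w : T, f w = c w := fun w => by simp [f]
    have h0 := h T hT f
    rw [← Finset.prod_coe_sort T] at h0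
    simp only [hf] at h0
    rw [← h0]
    congr 1
    funext ω
    rw [funext_iff, Subtype.forall]
    refine propext (forall_congr' fun w => forall_congr' fun hw => ?_)
    rw [← hf ⟨w, hw⟩]
  calc ∑ ω, μ ω * ∏ w ∈ T, φ w (X w ω)
      = ∑ ω, μ ω * (fun c : T → α => ∏ w : T, φ w (c w)) (fun w : T => X w ω) := by
        refine Finset.sum_congr rfl fun ω _ => ?_
        rw [← Finset.prod_coe_sort T]
    _ = ∑ c : T → α, ∏ w : T, φ w (c w) * pr μ (fun ω => X w ω = c w) := by
        refine (sum_mul_comp_eq (fun ω (w : T) => X w ω)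
          (fun c : T → α => ∏ w : T, φ w (c w))).trans ?_
        refine Finset.sum_congr rfl fun c _ => ?_
        rw [key, Finset.prod_mul_distrib]
    _ = ∏ w : T, ∑ c, φ w c * pr μ (fun ω => X w ω = c) := by
        rw [Finset.prod_univ_sum, Fintype.piFinset_univ]
    _ = ∏ w ∈ T, ∑ ω, μ ω * φ w (X w ω) := by
        rw [← Finset.prod_coe_sort T]
        simp only [sum_mul_comp_eq]

theorem kWiseIndep.comp_injective {V W α : Type*} [Nonempty α] {X : W → Ω → α} {k : ℕ}
    (h : kWiseIndep μ X k) {g : V → W} (hg : Function.Injective g) :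
    kWiseIndep μ (fun v => X (g v)) k := by
  intro T hT f
  have h0 := h (T.map ⟨g, hg⟩) (by simpa using hT) (Function.extend g f fun _ => Classical.arbitrary α)
  simpa [hg.extend_apply] using h0

/-- Number of tuples, weighted by `p` to the number of distinct entries, with few distinct
entries. -/
theorem sum_pow_card_image_le {W : Type*} [Fintype W] {p : ℝ} (hp : 0 ≤ p)
    (hL : 1 ≤ Fintype.card W * p) (k h : ℕ) :
    ∑ f : Fin k → W, (if (Finset.univ.image f).card ≤ h
        then p ^ (Finset.univ.image f).card else 0)
      ≤ (h + 1) * ((h : ℝ) ^ k * (Fintype.card W * p) ^ h) := by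
  let g : ℕ → ℝ := fun j => if j ≤ h then p ^ j else 0
  have hg : ∀ j, 0 ≤ g j := fun j => by simp only [g]; split_ifs <;> positivity
  calc ∑ f : Fin k → W, g (Finset.univ.image f).card
      ≤ ∑ f : Fin k → W, ∑ T : Finset W, (if ∀ i, f i ∈ T then g T.card else 0) := by
        refine Finset.sum_le_sum fun f _ => ?_
        have hnn : ∀ T ∈ (Finset.univ : Finset (Finset W)),
            0 ≤ if ∀ i, f i ∈ T then g T.card else 0 := fun T _ => by
          split_ifs <;> simp [hg]
        calc g (Finset.univ.image f).card
            = if ∀ i, f i ∈ Finset.univ.image f then g (Finset.univ.image f).card else 0 := by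
              rw [if_pos fun i => Finset.mem_image_of_mem f (Finset.mem_univ i)]
          _ ≤ _ := Finset.single_le_sum hnn (Finset.mem_univ _)
    _ = ∑ T ∈ (Finset.univ : Finset W).powerset, (T.card : ℝ) ^ k * g T.card := by
        rw [Finset.sum_comm, Finset.powerset_univ]
        refine Finset.sum_congr rfl fun T _ => ?_
        rw [← Finset.sum_filter, Finset.sum_const, nsmul_eq_mul]
        congr 1
        have : (Finset.univ.filter fun f : Fin k → W => ∀ i, f i ∈ T) =
            Fintype.piFinset fun _ => T := by
          ext f; simp
        rw [this]
        simp
    _ = ∑ j ∈ Finset.range (Fintype.card W + 1),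
          (Fintype.card W).choose j * ((j : ℝ) ^ k * g j) := by
        rw [Finset.sum_powerset_apply_card fun j => (j : ℝ) ^ k * g j]
        simp
    _ ≤ ∑ j ∈ Finset.range (Fintype.card W + 1),
          if j ≤ h then (h : ℝ) ^ k * (Fintype.card W * p) ^ h else 0 := by
        refine Finset.sum_le_sum fun j _ => ?_
        simp only [g]
        split_ifs with hj
        · calc ((Fintype.card W).choose j : ℝ) * ((j : ℝ) ^ k * p ^ j)
              ≤ (Fintype.card W : ℝ) ^ j * ((h : ℝ) ^ k * p ^ j) := by
                gcongr
                exact_mod_cast Nat.choose_le_pow _ _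
            _ = (h : ℝ) ^ k * (Fintype.card W * p) ^ j := by rw [mul_pow]; ring
            _ ≤ _ := by gcongr
        · simp
    _ ≤ (h + 1) * ((h : ℝ) ^ k * (Fintype.card W * p) ^ h) := by
        rw [← Finset.sum_filter, Finset.sum_const, nsmul_eq_mul]
        gcongr
        have : ((Finset.range (Fintype.card W + 1)).filter (· ≤ h)).card ≤ h + 1 := by
          rw [← Finset.card_range (h + 1)]
          refine Finset.card_le_card fun j => ?_
          simp
        exact_mod_cast this

/-- Even moments of a sum of centred, `[-1,1]`-valued, `2h`-wise independent variables. -/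
theorem kWiseIndep.moment_le {W α : Type*} [Fintype W] [Fintype α] [Nonempty α]
    (hμ : ∀ ω, 0 ≤ μ ω) {X : W → Ω → α} {h : ℕ} (hX : kWiseIndep μ X (h + h))
    {φ : α → ℝ} (hφ : ∀ c, |φ c| ≤ 1) (hmean : ∀ w, ∑ ω, μ ω * φ (X w ω) = 0)
    {p : ℝ} (hp : 0 ≤ p) (hvar : ∀ w, ∑ ω, μ ω * φ (X w ω) ^ 2 ≤ p)
    (hL : 1 ≤ Fintype.card W * p) :
    ∑ ω, μ ω * (∑ w, φ (X w ω)) ^ (h + h)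
      ≤ (h + 1) * ((h : ℝ) ^ (h + h) * (Fintype.card W * p) ^ h) := by
  have hpow : ∀ w j, 2 ≤ j → |∑ ω, μ ω * φ (X w ω) ^ j| ≤ p := by
    intro w j hj
    refine (Finset.abs_sum_le_sum_abs _ _).trans (le_trans ?_ (hvar w))
    refine Finset.sum_le_sum fun ω _ => ?_
    rw [abs_mul, abs_of_nonneg (hμ ω), abs_pow, ← sq_abs (φ _)]
    exact mul_le_mul_of_nonneg_left (pow_le_pow_of_le_one (abs_nonneg _) (hφ _) hj) (hμ ω)
  refine le_trans ?_ (sum_pow_card_image_le hp hL (h + h) h)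
  simp only [Fintype.sum_pow, Finset.mul_sum]
  rw [Finset.sum_comm]
  refine Finset.sum_le_sum fun f _ => ?_
  set T := Finset.univ.image f with hT
  let m : W → ℕ := fun w => (Finset.univ.filter fun i => f i = w).card
  have hTk : T.card ≤ h + h := by simpa using Finset.card_image_le (s := Finset.univ) (f := f)
  have hprod : ∑ ω, μ ω * ∏ i, φ (X (f i) ω) = ∏ w ∈ T, ∑ ω, μ ω * φ (X w ω) ^ m w := by
    rw [← hX.sum_mul_prod hTk fun w c => φ c ^ m w]
    refine Finset.sum_congr rfl fun ω _ => ?_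
    rw [Finset.prod_comp (fun w => φ (X w ω)) f]
  rw [hprod]
  by_cases h1 : ∃ w ∈ T, m w = 1
  · obtain ⟨w, hw, hm⟩ := h1
    rw [Finset.prod_eq_zero hw (by simpa [hm] using hmean w)]
    split_ifs <;> positivity
  push Not at h1
  have h2 : ∀ w ∈ T, 2 ≤ m w := by
    intro w hw
    have h0 : 0 < m w := by
      obtain ⟨i, -, hi⟩ := Finset.mem_image.1 hw
      exact Finset.card_pos.2 ⟨i, by simp [hi]⟩
    have := h1 w hw
    omega
  have hsum : ∑ w ∈ T, m w = h + h := by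
    have := Finset.card_eq_sum_card_image f (Finset.univ : Finset (Fin (h + h)))
    simpa using this.symm
  have hle : T.card * 2 ≤ h + h := by
    rw [← hsum, ← smul_eq_mul]
    exact Finset.card_nsmul_le_sum _ _ _ h2
  rw [if_pos (by omega)]
  refine (le_abs_self _).trans ?_
  rw [Finset.abs_prod]
  calc ∏ w ∈ T, |∑ ω, μ ω * φ (X w ω) ^ m w| ≤ ∏ _w ∈ T, p :=
        Finset.prod_le_prod (fun _ _ => abs_nonneg _) fun w hw => hpow w _ (h2 w hw)
    _ = p ^ T.card := Finset.prod_const p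

end FiniteProbability

/-- If every output distribution has density at most `1 + δ` with respect to the uniform
distribution, then the mutual information is at most `log₂ (1 + δ)`. -/
theorem mutualInfo_le_of_density_le {M Z : Type*} [Fintype M] [Fintype Z]
    {PM : M → ℝ} {q : M → Z → ℝ} {p δ : ℝ} (hPM : ∀ m, 0 ≤ PM m) (hPM1 : ∑ m, PM m = 1)
    (hq : ∀ m z, 0 ≤ q m z) (hq1 : ∀ m, ∑ z, q m z = 1) (hp : 0 < p)
    (hcard : Fintype.card Z * p = 1) (hqp : ∀ m z, q m z ≤ (1 + δ) * p) (hδ : 0 < δ) :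
    mutualInfo (fun m z => PM m * q m z) ≤ Real.logb 2 (1 + δ) := by
  have hlog2 : 0 < Real.log 2 := Real.log_pos one_lt_two
  set Q : Z → ℝ := fun z => ∑ m, PM m * q m z with hQ
  have hrow : ∀ m, ∑ z, PM m * q m z = PM m := fun m => by rw [← Finset.mul_sum, hq1, mul_one]
  have hP : ∀ m z, 0 ≤ PM m * q m z := fun m z => mul_nonneg (hPM m) (hq m z)
  have hterm : ∀ m z, PM m * q m z * Real.logb 2 (PM m * q m z / (PM m * Q z)) ≤
      PM m * q m z * Real.logb 2 (1 + δ) +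
        (PM m * q m z * (p / Q z) - PM m * q m z) / Real.log 2 := by
    intro m z
    rcases (hP m z).eq_or_lt with h0 | h0
    · simp [← h0]
    have hm : 0 < PM m := (hPM m).lt_of_ne fun h => by simp [← h] at h0
    have hqz : 0 < q m z := (hq m z).lt_of_ne fun h => by simp [← h] at h0
    have hQz : 0 < Q z := h0.trans_le
      (Finset.single_le_sum (f := fun m => PM m * q m z) (fun m _ => hP m z) (Finset.mem_univ m))
    have hsplit : PM m * q m z / (PM m * Q z) = q m z / p * (p / Q z) := by
      field_simp
    rw [hsplit, Real.logb_mul (by positivity) (by positivity)]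
    have h1 : Real.logb 2 (q m z / p) ≤ Real.logb 2 (1 + δ) := by
      refine Real.logb_le_logb_of_le one_lt_two (by positivity) ?_
      rw [div_le_iff₀ hp]
      exact hqp m z
    have h2 : Real.logb 2 (p / Q z) ≤ (p / Q z - 1) / Real.log 2 := by
      rw [Real.logb]
      gcongr
      exact Real.log_le_sub_one_of_pos (by positivity)
    calc _ ≤ PM m * q m z * (Real.logb 2 (1 + δ) + (p / Q z - 1) / Real.log 2) := by gcongr
      _ = _ := by ring
  have hQp : ∀ z, ∑ m, PM m * q m z * (p / Q z) ≤ p := by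
    intro z
    rw [← Finset.sum_mul]
    change Q z * (p / Q z) ≤ p
    rcases eq_or_ne (Q z) 0 with h | h
    · simp [h, hp.le]
    · rw [mul_div_cancel₀ _ h]
  have htot : ∑ m, ∑ z, PM m * q m z = 1 := by simp only [hrow, hPM1]
  have hratio : ∑ m, ∑ z, PM m * q m z * (p / Q z) ≤ 1 := by
    rw [Finset.sum_comm, ← hcard]
    calc _ ≤ ∑ _z : Z, p := Finset.sum_le_sum fun z _ => hQp z
      _ = _ := by simp
  calc mutualInfo (fun m z => PM m * q m z)
      ≤ ∑ m, ∑ z, (PM m * q m z * Real.logb 2 (1 + δ) +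
        (PM m * q m z * (p / Q z) - PM m * q m z) / Real.log 2) := by
        unfold mutualInfo
        simp only [hrow]
        exact Finset.sum_le_sum fun m _ => Finset.sum_le_sum fun z _ => hterm m z
    _ = Real.logb 2 (1 + δ) +
        (∑ m, ∑ z, PM m * q m z * (p / Q z) - 1) / Real.log 2 := by
        simp only [Finset.sum_add_distrib, ← Finset.sum_mul, ← Finset.sum_div,
          Finset.sum_sub_distrib, htot, one_mul]
    _ ≤ Real.logb 2 (1 + δ) := by
        have : (∑ m, ∑ z, PM m * q m z * (p / Q z) - 1) / Real.log 2 ≤ 0 :=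
          div_nonpos_of_nonpos_of_nonneg (by linarith) hlog2.le
        linarith

theorem logb_two_one_add_le {δ : ℝ} (hδ : 0 < δ) : Real.logb 2 (1 + δ) ≤ 2 * δ := by
  have h2 : (1 / 2 : ℝ) < Real.log 2 := by linarith [Real.log_two_gt_d9]
  rw [Real.logb, div_le_iff₀ (by linarith)]
  have := Real.log_le_sub_one_of_pos (show 0 < 1 + δ by linarith)
  nlinarith

/-- Number of values of the key for which message `m` shows `z` on the coordinates in `S`. -/
noncomputable def keyCount {n : ℕ} {M W : Type*} [Fintype W] (x : M → W → Fin n → ZMod 2)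
    (S : Finset (Fin n)) (m : M) (z : {i : Fin n // i ∈ S} → ZMod 2) : ℕ :=
  (Finset.univ.filter (fun w : W => (fun i : {i : Fin n // i ∈ S} => x m w i.val) = z)).card

theorem semLeak_le_of_keyCount_le {n : ℕ} {M W : Type*} [Fintype M] [Fintype W] [Nonempty W]
    {s : ℕ} {x : M → W → Fin n → ZMod 2} {δ : ℝ} (hδ : 0 < δ)
    (hx : ∀ S ∈ (Finset.univ : Finset (Fin n)).powersetCard s, ∀ m z,
      (keyCount x S m z : ℝ) ≤ (1 + δ) * (Fintype.card W * ((2 : ℝ) ^ s)⁻¹)) :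
    semLeak s x ≤ 2 * δ := by
  refine Real.sSup_le ?_ (by positivity)
  rintro I ⟨PM, S, hPM, hPM1, hS, rfl⟩
  have hW : (0 : ℝ) < Fintype.card W := by exact_mod_cast Fintype.card_pos
  refine le_trans (mutualInfo_le_of_density_le (p := ((2 : ℝ) ^ s)⁻¹)
    (q := fun m z => (keyCount x S m z : ℝ) / Fintype.card W) hPM hPM1 (fun m z => by positivity)
    (fun m => ?_) (by positivity) ?_ (fun m z => ?_) hδ) (logb_two_one_add_le hδ)
  · rw [← Finset.sum_div, div_eq_one_iff_eq hW.ne']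
    unfold keyCount
    rw [← Nat.cast_sum, ← Finset.card_eq_sum_card_fiberwise fun _ _ => Finset.mem_univ _]
    simp
  · simp [ZMod.card, hS]
  · rw [div_le_iff₀ hW]
    linarith [hx S (Finset.mem_powersetCard.2 ⟨Finset.subset_univ S, hS⟩) m z]

theorem card_filter_restrict_eq {n : ℕ} (S : Finset (Fin n))
    (z : {i : Fin n // i ∈ S} → ZMod 2) :
    (Finset.univ.filter (fun c : Fin n → ZMod 2 =>
      (fun i : {i : Fin n // i ∈ S} => c i.val) = z)).card * 2 ^ S.card = 2 ^ n := by
  have h : (Finset.univ.filter (fun c : Fin n → ZMod 2 =>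
      (fun i : {i : Fin n // i ∈ S} => c i.val) = z)) =
      Fintype.piFinset fun i => if hi : i ∈ S then {z ⟨i, hi⟩} else Finset.univ := by
    ext c
    simp only [Finset.mem_filter, Finset.mem_univ, true_and, Fintype.mem_piFinset, funext_iff,
      Subtype.forall]
    refine forall_congr' fun i => ?_
    by_cases hi : i ∈ S <;> simp [hi]
  have hcard : ∀ i : Fin n, (if hi : i ∈ S then ({z ⟨i, hi⟩} : Finset (ZMod 2))
      else Finset.univ).card = if i ∈ S then 1 else 2 := fun i => by
    by_cases hi : i ∈ S <;> simp [hi, ZMod.card]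
  rw [h, Fintype.card_piFinset]
  simp only [hcard]
  rw [Finset.prod_ite, Finset.prod_const_one, one_mul, Finset.prod_const, ← pow_add,
    ← Finset.compl_filter, Finset.card_compl]
  have : S.card ≤ n := by simpa using Finset.card_le_univ S
  simp
  omega

/-- Deviation bound for a single message, read set and observed value. -/
theorem pr_keyCount_gt_le {Ω : Type*} [Fintype Ω] {μ : Ω → ℝ} (hμ : ∀ ω, 0 ≤ μ ω)
    (hμ1 : ∑ ω, μ ω = 1) {n : ℕ} {M W : Type*} [Fintype W] {X : Ω → M × W → Fin n → ZMod 2}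
    {h : ℕ} (hX : kWiseIndep μ (fun mw ω => X ω mw) (h + h))
    (hunif : ∀ mw c, pr μ (fun ω => X ω mw = c) = 1 / (2 : ℝ) ^ n)
    (S : Finset (Fin n)) (m : M) (z : {i : Fin n // i ∈ S} → ZMod 2) {δ : ℝ} (hδ : 0 < δ)
    (hL : 1 ≤ Fintype.card W * ((2 : ℝ) ^ S.card)⁻¹) :
    pr μ (fun ω => (1 + δ) * (Fintype.card W * ((2 : ℝ) ^ S.card)⁻¹) <
        keyCount (fun m w => X ω (m, w)) S m z)
      ≤ (h + 1) * ((h : ℝ) ^ (h + h) * (Fintype.card W * ((2 : ℝ) ^ S.card)⁻¹) ^ h) /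
        (δ * (Fintype.card W * ((2 : ℝ) ^ S.card)⁻¹)) ^ (h + h) := by
  set p : ℝ := ((2 : ℝ) ^ S.card)⁻¹ with hp
  have hp0 : 0 < p := by positivity
  have hp1 : p ≤ 1 := inv_le_one_of_one_le₀ (one_le_pow₀ one_le_two)
  let B : (Fin n → ZMod 2) → ℝ := fun c =>
    if (fun i : {i : Fin n // i ∈ S} => c i.val) = z then 1 else 0
  have hBsq : ∀ c, B c ^ 2 = B c := fun c => by simp only [B]; split_ifs <;> simp
  have hB0 : ∀ c, 0 ≤ B c := fun c => by simp only [B]; split_ifs <;> simp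
  have hB1 : ∀ c, B c ≤ 1 := fun c => by simp only [B]; split_ifs <;> simp
  have hEB : ∀ w, ∑ ω, μ ω * B (X ω (m, w)) = p := by
    intro w
    rw [sum_mul_comp_eq (fun ω => X ω (m, w))]
    simp only [hunif, B]
    rw [← Finset.sum_mul, Finset.sum_boole]
    have := card_filter_restrict_eq S z
    rw [hp, mul_one_div, div_eq_iff (by positivity), eq_comm, inv_mul_eq_iff_eq_mul₀ (by positivity)]
    rw [mul_comm]
    exact_mod_cast this.symm
  have hmoment := kWiseIndep.moment_le hμ
    (hX.comp_injective (g := fun w : W => (m, w)) (Prod.mk_right_injective m))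
    (φ := fun c => B c - p) (p := p)
    (fun c => abs_le.2 ⟨by linarith [hB0 c], by linarith [hB1 c]⟩)
    (fun w => by simp only [mul_sub, Finset.sum_sub_distrib, ← Finset.sum_mul, hEB, hμ1]; ring)
    hp0.le
    (fun w => by
      have : ∀ ω, μ ω * (B (X ω (m, w)) - p) ^ 2 =
          μ ω * B (X ω (m, w)) * (1 - 2 * p) + μ ω * p ^ 2 := fun ω => by
        rw [sub_sq, hBsq]; ring
      simp only [this, Finset.sum_add_distrib, ← Finset.sum_mul, hEB, hμ1]
      nlinarith)
    hL
  have hcount : ∀ ω, (keyCount (fun m w => X ω (m, w)) S m z : ℝ) =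
      ∑ w, (B (X ω (m, w)) - p) + Fintype.card W * p := by
    intro ω
    simp [keyCount, B]
  refine le_trans (pr_mono hμ fun ω hω => ?_)
    (pr_lt_le_of_moment hμ (mul_pos hδ (by linarith)) ⟨h, rfl⟩ hmoment)
  rw [hcount] at hω
  linarith

/-- Secrecy analysis: for `R' > r` there are `γ₀, γ₁ > 0` (depending only on `r` and
`R'`) such that, for every even `k ≥ 4` and all large `n`, a random `[n,Rn,R'n]` code
with `k`-wise independent codewords, each uniform on `{0,1}ⁿ`, satisfies
`Pr[ Sem(𝒞ₙ) > 2^{−γ₁rn} ] ≤ 2^{(−kγ₀r + r + R + 1)n}`. -/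
theorem kwise_independent_random_codes_semantically_secret
    (r R' : ℝ) (hr0 : 0 < r) (hr1 : r ≤ 1) (hR' : r < R') :
    ∃ γ₀ γ₁ : ℝ, 0 < γ₀ ∧ 0 < γ₁ ∧
      ∀ R : ℝ, 0 < R →
      ∀ k : ℕ, Even k → 4 ≤ k →
        ∃ n₀ : ℕ, ∀ n : ℕ, n₀ ≤ n →
          ∀ a b s : ℕ, (a : ℝ) = R * n → (b : ℝ) = R' * n → (s : ℝ) = r * n →
          ∀ (Ω : Type) [Fintype Ω] (μ : Ω → ℝ),
            (∀ ω, 0 ≤ μ ω) → (∑ ω, μ ω) = 1 →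
            ∀ X : Ω → (Fin a → ZMod 2) × (Fin b → ZMod 2) → (Fin n → ZMod 2),
              kWiseIndep μ (fun mw ω => X ω mw) k →
              (∀ mw (c : Fin n → ZMod 2),
                pr μ (fun ω => X ω mw = c) = 1 / (2 : ℝ) ^ n) →
              pr μ (fun ω =>
                  (2 : ℝ) ^ (-(γ₁ * r * n)) <
                    semLeak s (fun m w => X ω (m, w)))
                ≤ (2 : ℝ) ^ ((-(k : ℝ) * γ₀ * r + r + R + 1) * n) := by
  have hd : 0 < R' - r := sub_pos.2 hR'
  set d := R' - r with hd_def
  refine ⟨d / (8 * r), d / (8 * r), by positivity, by positivity, fun R _ k hk _ => ?_⟩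
  obtain ⟨h, rfl⟩ := hk
  let C : ℕ := (h + 1) * h ^ (h + h)
  refine ⟨⌈8 * (C + 1) / d⌉₊, fun n hn a b s ha hb hs Ω _ μ hμ hμ1 X hX hunif => ?_⟩
  have hdn : (C : ℝ) + 1 ≤ d * n / 8 := by
    have := (Nat.ceil_le.1 hn)
    rw [div_le_iff₀ hd] at this
    linarith
  set δ : ℝ := (2 : ℝ) ^ (-(d * n / 4)) with hδ_def
  have hδ : 0 < δ := by positivity
  set Λ : ℝ := (2 : ℝ) ^ (d * n) with hΛ_def
  have hmean : (Fintype.card (Fin b → ZMod 2) : ℝ) * ((2 : ℝ) ^ s)⁻¹ = Λ := by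
    have hcard : (Fintype.card (Fin b → ZMod 2) : ℝ) = (2 : ℝ) ^ b := by simp [ZMod.card]
    rw [hcard, ← Real.rpow_natCast, ← Real.rpow_natCast, ← Real.rpow_neg zero_le_two,
      ← Real.rpow_add two_pos, hb, hs, hΛ_def, hd_def]
    congr 1
    ring
  have hΛ1 : 1 ≤ Λ := Real.one_le_rpow one_le_two (by positivity)
  have hC : (C : ℝ) ≤ (2 : ℝ) ^ (d * n * (h + h) / 8) := by
    rcases Nat.eq_zero_or_pos h with rfl | hh
    · simp [C]
    have hh1 : (1 : ℝ) ≤ h := by exact_mod_cast hh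
    calc (C : ℝ) ≤ (2 : ℝ) ^ (C : ℝ) := by
          rw [Real.rpow_natCast]
          exact_mod_cast Nat.lt_two_pow_self.le
      _ ≤ _ := Real.rpow_le_rpow_of_exponent_le one_le_two (by nlinarith)
  have hbound : (h + 1) * ((h : ℝ) ^ (h + h) * Λ ^ h) / (δ * Λ) ^ (h + h) ≤
      (2 : ℝ) ^ (-(d * n * (h + h) / 8)) := by
    have hexp : Λ ^ h / (δ * Λ) ^ (h + h) = (2 : ℝ) ^ (-(d * n * (h + h) / 4)) := by
      rw [hδ_def, hΛ_def, ← Real.rpow_add two_pos, ← Real.rpow_mul_natCast zero_le_two,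
        ← Real.rpow_mul_natCast zero_le_two, ← Real.rpow_sub two_pos]
      congr 1
      push_cast
      ring
    calc (h + 1) * ((h : ℝ) ^ (h + h) * Λ ^ h) / (δ * Λ) ^ (h + h)
        = C * (Λ ^ h / (δ * Λ) ^ (h + h)) := by simp only [C]; push_cast; ring
      _ ≤ (2 : ℝ) ^ (d * n * (h + h) / 8) * (2 : ℝ) ^ (-(d * n * (h + h) / 4)) := by
        rw [hexp]
        gcongr
      _ = (2 : ℝ) ^ (-(d * n * (h + h) / 8)) := by
        rw [← Real.rpow_add two_pos]
        congr 1
        ring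
  set c : ℝ := (2 : ℝ) ^ (-(d * n * (h + h) / 8)) with hc_def
  have hthreshold : 2 * δ ≤ (2 : ℝ) ^ (-(d / (8 * r) * r * n)) := by
    calc 2 * δ = (2 : ℝ) ^ (1 + -(d * n / 4)) := by
          rw [Real.rpow_add two_pos, Real.rpow_one]
      _ ≤ _ := by
          refine Real.rpow_le_rpow_of_exponent_le one_le_two ?_
          have : d / (8 * r) * r * n = d * n / 8 := by field_simp
          have : (0 : ℝ) ≤ C := by positivity
          linarith
  have hunion : pr μ (fun ω => ∃ S ∈ (Finset.univ : Finset (Fin n)).powersetCard s,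
      ∃ m ∈ Finset.univ, ∃ z ∈ Finset.univ,
        (1 + δ) * Λ < keyCount (fun m w => X ω (m, w)) S m z) ≤
      ((Finset.univ : Finset (Fin n)).powersetCard s).card * ((2 : ℝ) ^ a * ((2 : ℝ) ^ s * c)) := by
    refine pr_exists_le hμ _ _ fun S hS => ?_
    obtain rfl := (Finset.mem_powersetCard.1 hS).2
    have hM : ((Finset.univ : Finset (Fin a → ZMod 2)).card : ℝ) = 2 ^ a := by simp [ZMod.card]
    have hZ : ((Finset.univ : Finset ({i : Fin n // i ∈ S} → ZMod 2)).card : ℝ) = 2 ^ S.card := by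
      simp [ZMod.card]
    rw [← hM, ← hZ]
    refine pr_exists_le hμ _ _ fun m _ => pr_exists_le hμ _ _ fun z _ => ?_
    refine le_trans ?_ hbound
    rw [← hmean] at hΛ1 ⊢
    exact pr_keyCount_gt_le hμ hμ1 hX hunif S m z hδ hΛ1
  calc _ ≤ _ := pr_mono hμ fun ω hω => ?_
    _ ≤ _ := hunion
    _ ≤ (2 : ℝ) ^ n * ((2 : ℝ) ^ a * ((2 : ℝ) ^ s * c)) := by
      gcongr
      rw [Finset.card_powersetCard, Finset.card_univ, Fintype.card_fin]
      exact_mod_cast Nat.choose_le_two_pow n s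
    _ = _ := by
      rw [← Real.rpow_natCast 2 n, ← Real.rpow_natCast 2 a, ← Real.rpow_natCast 2 s, ha, hs,
        hc_def, ← Real.rpow_add two_pos, ← Real.rpow_add two_pos, ← Real.rpow_add two_pos]
      congr 1
      push_cast
      field_simp
      ring
  by_contra hno
  push Not at hno
  refine absurd hω (not_lt.2 (le_trans (semLeak_le_of_keyCount_le hδ fun S hS m z => ?_) hthreshold))
  rw [hmean]
  exact hno S hS m (Finset.mem_univ m) z (Finset.mem_univ z)
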